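/- Let d ≥ 1 and n ≥ 1 be integers, K > 0 and 0 < ε ≤ K. Then there exists a constant N depending only on n, d and K such that the following holds. For every n times continuously differentiable map c : ℝᵈ → ℝᵈ satisfying |∂^β c^ρ(x)| ≤ ε for all x ∈ ℝᵈ, all 1 ≤ ρ ≤ d and all multi-indices β with |β| ≤ n, every n times continuously differentiable function u : ℝᵈ → ℝ, every multi-index α with |α| = n, and every x ∈ ℝᵈ: | ∂^α( u ∘ T_c )(x) − (∂^α u)(x + c(x)) | ≤ N ε Σ_{1 ≤ |ζ| ≤ n} |(∂^ζ u)(x + c(x))|, where T_c(x) := x + c(x). -/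

import Mathlib

open MeasureTheory Finset
open scoped ENNReal

/-- Partial derivative in direction `i`. -/
noncomputable def pd {d : ℕ} (i : Fin d) (f : EuclideanSpace ℝ (Fin d) → ℝ) :
    EuclideanSpace ℝ (Fin d) → ℝ :=
  fun x => fderiv ℝ f x (EuclideanSpace.single i 1)

/-- Multi-index partial derivative `∂^ζ`. -/
noncomputable def mpd {d : ℕ} (ζ : Fin d → ℕ) (f : EuclideanSpace ℝ (Fin d) → ℝ) :
    EuclideanSpace ℝ (Fin d) → ℝ :=
  (List.finRange d).foldr (fun i g => (pd i)^[ζ i] g) f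

/-- Jacobian matrix of a map `ℝᵈ → ℝᵈ`. -/
noncomputable def jac {d : ℕ} (c : EuclideanSpace ℝ (Fin d) → EuclideanSpace ℝ (Fin d))
    (x : EuclideanSpace ℝ (Fin d)) : Matrix (Fin d) (Fin d) ℝ :=
  Matrix.of fun i j => fderiv ℝ (fun y => c y i) x (EuclideanSpace.single j 1)

/-- The finite set of multi-indices `ζ ∈ ℕᵈ` with `|ζ| ≤ n`. -/
def midx (d n : ℕ) : Finset (Fin d → ℕ) :=
  (Finset.univ.image (fun f : Fin d → Fin (n + 1) => fun i => (f i : ℕ))).filter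
    (fun ζ => ∑ i, ζ i ≤ n)

open scoped ContDiff

section FaaDiBruno

variable {E F : Type*} [NormedAddCommGroup E] [NormedSpace ℝ E]
  [NormedAddCommGroup F] [NormedSpace ℝ F]

lemma norm_iteratedFDeriv_add_const_le_one (a x : E) {k : ℕ} (hk : k ≠ 0) :
    ‖iteratedFDeriv ℝ k (fun z : E => z + a) x‖ ≤ 1 := by
  obtain ⟨p, rfl⟩ := Nat.exists_eq_succ_of_ne_zero hk
  have h : fderiv ℝ (fun z : E => z + a) = fun _ => ContinuousLinearMap.id ℝ E := by
    ext1 z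
    simp [fderiv_add_const]
  rw [Nat.succ_eq_add_one, ← norm_iteratedFDeriv_fderiv, h]
  rcases Nat.eq_zero_or_pos p with rfl | hp
  · simpa using ContinuousLinearMap.norm_id_le
  · simp [iteratedFDeriv_const_of_ne hp.ne']

/-- Derivatives of a composition with a perturbation of the identity, estimated term by term in
the Faà di Bruno formula. -/
lemma norm_iteratedFDeriv_comp_add_sub_le {n : ℕ} (hn : n ≠ 0) {c : E → E} {u : E → F}
    (hc : ContDiff ℝ n c) (hu : ContDiff ℝ n u) (x : E) {δ : ℝ} (hδ : 0 ≤ δ)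
    (hb : ∀ k ∈ Finset.Icc 1 n, ‖iteratedFDeriv ℝ k c x‖ ≤ δ) :
    ‖iteratedFDeriv ℝ n (fun y => u (y + c y)) x - iteratedFDeriv ℝ n u (x + c x)‖ ≤
      Fintype.card (OrderedFinpartition n) * (n * (1 + δ) ^ n * δ) *
        ∑ k ∈ Finset.Icc 1 n, ‖iteratedFDeriv ℝ k u (x + c x)‖ := by
  set T : E → E := fun y => y + c y
  set τ : E → E := fun y => y + c x
  set S := ∑ k ∈ Finset.Icc 1 n, ‖iteratedFDeriv ℝ k u (x + c x)‖
  have hτ : ContDiff ℝ n τ := contDiff_id.add contDiff_const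
  have hT : ContDiff ℝ n T := contDiff_id.add hc
  have e₁ := iteratedFDeriv_comp (x := x) (f := T) hu.contDiffAt hT.contDiffAt le_rfl
  have e₂ := iteratedFDeriv_comp (x := x) (f := τ) hu.contDiffAt hτ.contDiffAt le_rfl
  have e₃ : iteratedFDeriv ℝ n (u ∘ τ) x = iteratedFDeriv ℝ n u (x + c x) :=
    iteratedFDeriv_comp_add_right n (c x) x
  have hdiff : ∀ k, 1 ≤ k → k ≤ n →
      iteratedFDeriv ℝ k T x - iteratedFDeriv ℝ k τ x = iteratedFDeriv ℝ k c x := by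
    intro k h1 hk
    have hk' : (k : ℕ∞ω) ≤ n := by exact_mod_cast hk
    have a₁ : iteratedFDeriv ℝ k T x =
        iteratedFDeriv ℝ k (fun y : E => y) x + iteratedFDeriv ℝ k c x :=
      fun_iteratedFDeriv_add_apply contDiff_id.contDiffAt (hc.of_le hk').contDiffAt
    have a₂ : iteratedFDeriv ℝ k τ x = iteratedFDeriv ℝ k (fun y : E => y) x +
        iteratedFDeriv ℝ k (fun _ : E => c x) x :=
      fun_iteratedFDeriv_add_apply contDiff_id.contDiffAt contDiff_const.contDiffAt
    rw [a₁, a₂, iteratedFDeriv_const_of_ne (by omega)]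
    simp
  have hnτ : ∀ k, 1 ≤ k → ‖iteratedFDeriv ℝ k τ x‖ ≤ 1 := fun k hk =>
    norm_iteratedFDeriv_add_const_le_one _ _ (by omega)
  have hnT : ∀ k, 1 ≤ k → k ≤ n → ‖iteratedFDeriv ℝ k T x‖ ≤ 1 + δ := by
    intro k h1 hk
    rw [eq_add_of_sub_eq' (hdiff k h1 hk)]
    exact (norm_add_le _ _).trans
      (add_le_add (hnτ k h1) (hb k (Finset.mem_Icc.2 ⟨h1, hk⟩)))
  change ‖iteratedFDeriv ℝ n (u ∘ T) x - _‖ ≤ _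
  rw [← e₃, e₁, e₂]
  simp only [FormalMultilinearSeries.taylorComp, ← Finset.sum_sub_distrib]
  refine (norm_sum_le _ _).trans ?_
  have key : ∀ p : OrderedFinpartition n,
      ‖FormalMultilinearSeries.compAlongOrderedFinpartition (ftaylorSeries ℝ u (T x))
          (ftaylorSeries ℝ T x) p -
        FormalMultilinearSeries.compAlongOrderedFinpartition (ftaylorSeries ℝ u (τ x))
          (ftaylorSeries ℝ τ x) p‖ ≤ (n * (1 + δ) ^ n * δ) * S := by
    intro p
    refine (p.norm_compAlongOrderedFinpartition_sub_compAlongOrderedFinpartition_le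
      (iteratedFDeriv ℝ p.length u (x + c x)) (iteratedFDeriv ℝ p.length u (x + c x))
      (fun i => iteratedFDeriv ℝ (p.partSize i) T x)
      (fun i => iteratedFDeriv ℝ (p.partSize i) τ x)).trans ?_
    rw [sub_self, norm_zero, zero_mul, add_zero]
    have h₁ : ‖iteratedFDeriv ℝ p.length u (x + c x)‖ ≤ S :=
      Finset.single_le_sum (f := fun k => ‖iteratedFDeriv ℝ k u (x + c x)‖)
        (fun _ _ => norm_nonneg _)
        (Finset.mem_Icc.2 ⟨p.length_pos (Nat.pos_of_ne_zero hn), p.length_le⟩)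
    have h₂ : ‖fun i => iteratedFDeriv ℝ (p.partSize i) T x‖ ≤ 1 + δ :=
      (pi_norm_le_iff_of_nonneg (by positivity)).2 fun i =>
        hnT _ (p.partSize_pos i) (p.partSize_le i)
    have h₃ : ‖fun i => iteratedFDeriv ℝ (p.partSize i) τ x‖ ≤ 1 + δ :=
      (pi_norm_le_iff_of_nonneg (by positivity)).2 fun i =>
        (hnτ _ (p.partSize_pos i)).trans (by linarith)
    have h₄ : ‖(fun i => iteratedFDeriv ℝ (p.partSize i) T x) -
        fun i => iteratedFDeriv ℝ (p.partSize i) τ x‖ ≤ δ := by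
      refine (pi_norm_le_iff_of_nonneg hδ).2 fun i => ?_
      rw [Pi.sub_apply, hdiff _ (p.partSize_pos i) (p.partSize_le i)]
      exact hb _ (Finset.mem_Icc.2 ⟨p.partSize_pos i, p.partSize_le i⟩)
    have h₅ : max ‖fun i => iteratedFDeriv ℝ (p.partSize i) T x‖
        ‖fun i => iteratedFDeriv ℝ (p.partSize i) τ x‖ ^ (p.length - 1) ≤ (1 + δ) ^ n :=
      (pow_le_pow_left₀ (le_max_of_le_left (norm_nonneg _)) (max_le h₂ h₃) _).trans
        (pow_le_pow_right₀ (by linarith) ((Nat.sub_le _ _).trans p.length_le))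
    have h₆ : (p.length : ℝ) ≤ n := by exact_mod_cast p.length_le
    calc _ ≤ S * n * (1 + δ) ^ n * δ := by gcongr
      _ = _ := by ring
  refine (Finset.sum_le_sum fun p _ => key p).trans_eq ?_
  rw [Finset.sum_const, Finset.card_univ, nsmul_eq_mul]
  ring

end FaaDiBruno

section MultiIndex

variable {d : ℕ}

lemma norm_le_sum_abs (y : EuclideanSpace ℝ (Fin d)) : ‖y‖ ≤ ∑ i, |y i| := by
  have h := (EuclideanSpace.basisFun (Fin d) ℝ).sum_repr y
  calc ‖y‖ = ‖∑ i, y i • EuclideanSpace.basisFun (Fin d) ℝ i‖ := by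
        conv_lhs => rw [← h]
        simp
    _ ≤ ∑ i, |y i| := (norm_sum_le _ _).trans_eq (by simp [norm_smul])

/-- The operator norm is controlled by the values on the standard basis. -/
lemma norm_multilinear_le_sum {k : ℕ} {G : Type*} [NormedAddCommGroup G] [NormedSpace ℝ G]
    (f : ContinuousMultilinearMap ℝ (fun _ : Fin k => EuclideanSpace ℝ (Fin d)) G) :
    ‖f‖ ≤ ∑ v : Fin k → Fin d, ‖f fun j => EuclideanSpace.single (v j) (1 : ℝ)‖ := by
  refine f.opNorm_le_bound (Finset.sum_nonneg fun _ _ => norm_nonneg _) fun m => ?_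
  have hm : m = fun j => ∑ i, m j i • EuclideanSpace.single i (1 : ℝ) := by
    ext1 j
    simpa using ((EuclideanSpace.basisFun (Fin d) ℝ).sum_repr (m j)).symm
  conv_lhs => rw [hm, ContinuousMultilinearMap.map_sum]
  rw [Finset.sum_mul]
  refine (norm_sum_le _ _).trans (Finset.sum_le_sum fun v _ => ?_)
  rw [f.map_smul_univ, norm_smul, norm_prod, mul_comm]
  gcongr with j
  exact PiLp.norm_apply_le (m j) (v j)

/-- Iterated partial derivative along a list of coordinate directions. -/
noncomputable def listPd (L : List (Fin d)) (f : EuclideanSpace ℝ (Fin d) → ℝ) :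
    EuclideanSpace ℝ (Fin d) → ℝ :=
  L.foldr pd f

lemma contDiff_pd {m : ℕ} {f : EuclideanSpace ℝ (Fin d) → ℝ} (hf : ContDiff ℝ (m + 1 : ℕ) f)
    (i : Fin d) : ContDiff ℝ m (pd i f) :=
  (hf.fderiv_right (m := m) (by norm_cast)).clm_apply contDiff_const

lemma contDiff_listPd {m : ℕ} {f : EuclideanSpace ℝ (Fin d) → ℝ} (L : List (Fin d))
    (hf : ContDiff ℝ (m + L.length : ℕ) f) : ContDiff ℝ m (listPd L f) := by
  induction L generalizing m with
  | nil => exact hf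
  | cons i L ih =>
    refine contDiff_pd (ih ?_) i
    convert hf using 2
    simp only [List.length_cons]
    ring

lemma pd_comm {f : EuclideanSpace ℝ (Fin d) → ℝ} (hf : ContDiff ℝ 2 f) (i j : Fin d) :
    pd i (pd j f) = pd j (pd i f) := by
  ext x
  have hd : DifferentiableAt ℝ (fderiv ℝ f) x :=
    ((hf.fderiv_right (m := 1) (by norm_num)).differentiable one_ne_zero) x
  have h : ∀ v w, fderiv ℝ (fun y => fderiv ℝ f y v) x w = fderiv ℝ (fderiv ℝ f) x w v := by
    intro v w
    rw [fderiv_clm_apply hd (differentiableAt_const v)]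
    simp
  refine (h _ _).trans (Eq.trans ?_ (h _ _).symm)
  exact (hf.contDiffAt.isSymmSndFDerivAt (by simp)) _ _

lemma listPd_perm {n : ℕ} {f : EuclideanSpace ℝ (Fin d) → ℝ} (hf : ContDiff ℝ n f)
    {L L' : List (Fin d)} (h : L.Perm L') (hL : L.length ≤ n) : listPd L f = listPd L' f := by
  induction h with
  | nil => rfl
  | cons i h ih =>
    exact congrArg (pd i) (ih (by simp only [List.length_cons] at hL; omega))
  | swap i j L =>
    refine pd_comm (contDiff_listPd (m := 2) L (hf.of_le ?_)) j i
    simp only [List.length_cons] at hL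
    exact_mod_cast (by omega : 2 + L.length ≤ n)
  | trans h₁ h₂ ih₁ ih₂ => exact (ih₁ hL).trans (ih₂ (h₁.length_eq ▸ hL))

lemma listPd_eq_iteratedFDeriv {n : ℕ} {f : EuclideanSpace ℝ (Fin d) → ℝ}
    (hf : ContDiff ℝ n f) (L : List (Fin d)) (hL : L.length ≤ n) (x : EuclideanSpace ℝ (Fin d)) :
    listPd L f x =
      iteratedFDeriv ℝ L.length f x fun j => EuclideanSpace.single (L.get j) (1 : ℝ) := by
  induction L generalizing x with
  | nil => rfl
  | cons i L ih =>
    have hL' : L.length < n := hL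
    have hd : DifferentiableAt ℝ (iteratedFDeriv ℝ L.length f) x :=
      hf.differentiable_iteratedFDeriv (by exact_mod_cast hL') x
    have e : listPd L f = fun y => iteratedFDeriv ℝ L.length f y
        fun j => EuclideanSpace.single (L.get j) (1 : ℝ) := funext (ih hL'.le)
    change fderiv ℝ (listPd L f) x _ = _
    rw [e]
    exact (hd.iteratedFDeriv_succ_apply_left'
      (m := fun j => EuclideanSpace.single ((i :: L).get j) (1 : ℝ))).symm

/-- The list in which each coordinate `i` occurs `ζ i` times, in increasing order. -/
def multiIndexList (ζ : Fin d → ℕ) : List (Fin d) :=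
  (List.finRange d).flatMap fun i => List.replicate (ζ i) i

lemma mpd_eq_listPd (ζ : Fin d → ℕ) (f : EuclideanSpace ℝ (Fin d) → ℝ) :
    mpd ζ f = listPd (multiIndexList ζ) f := by
  have hrep : ∀ (i : Fin d) (k : ℕ) (g : EuclideanSpace ℝ (Fin d) → ℝ),
      (List.replicate k i).foldr pd g = (pd i)^[k] g := by
    intro i k g
    induction k with
    | zero => rfl
    | succ k ih => rw [List.replicate_succ, List.foldr_cons, ih, Function.iterate_succ_apply']
  simp only [mpd, listPd, multiIndexList, List.foldr_flatMap, hrep]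

lemma count_multiIndexList (ζ : Fin d → ℕ) (i : Fin d) :
    (multiIndexList ζ).count i = ζ i := by
  rw [multiIndexList, List.count_flatMap, ← List.ofFn_eq_map, List.sum_ofFn]
  simp [List.count_replicate]

lemma length_multiIndexList (ζ : Fin d → ℕ) : (multiIndexList ζ).length = ∑ i, ζ i := by
  rw [multiIndexList, List.length_flatMap, ← List.ofFn_eq_map, List.sum_ofFn]
  simp

lemma sum_count_eq_length (L : List (Fin d)) : ∑ i, L.count i = L.length := by
  simpa using Multiset.sum_count_eq_card (s := Finset.univ) (m := (L : Multiset (Fin d)))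
    (fun _ _ => Finset.mem_univ _)

lemma mpd_count_eq_listPd {n : ℕ} {f : EuclideanSpace ℝ (Fin d) → ℝ} (hf : ContDiff ℝ n f)
    (L : List (Fin d)) (hL : L.length ≤ n) : mpd (fun i => L.count i) f = listPd L f := by
  rw [mpd_eq_listPd]
  refine (listPd_perm hf (List.perm_iff_count.2 fun i => ?_) hL).symm
  rw [count_multiIndexList]

/-- The norm of the `k`-th derivative is controlled by the partial derivatives of order `k`. -/
lemma norm_iteratedFDeriv_le_of_mpd_le {n k : ℕ} {f : EuclideanSpace ℝ (Fin d) → ℝ}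
    (hf : ContDiff ℝ n f) (hk : k ≤ n) {x : EuclideanSpace ℝ (Fin d)} {B : ℝ}
    (hB : ∀ ζ : Fin d → ℕ, ∑ i, ζ i = k → |mpd ζ f x| ≤ B) :
    ‖iteratedFDeriv ℝ k f x‖ ≤ d ^ k * B := by
  refine (norm_multilinear_le_sum _).trans ?_
  have h : ∀ v : Fin k → Fin d,
      ‖iteratedFDeriv ℝ k f x fun j => EuclideanSpace.single (v j) (1 : ℝ)‖ ≤ B := by
    intro v
    obtain ⟨L, rfl, hv⟩ : ∃ L : List (Fin d), ∃ h : L.length = k,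
        v = fun j => L.get (j.cast h.symm) :=
      ⟨List.ofFn v, List.length_ofFn, by ext j; simp⟩
    subst hv
    rw [Real.norm_eq_abs]
    refine le_of_eq_of_le (congrArg abs ?_) (hB (fun i => L.count i) (sum_count_eq_length L))
    rw [mpd_count_eq_listPd hf L hk, listPd_eq_iteratedFDeriv hf L hk]
    rfl
  refine (Finset.sum_le_sum fun v _ => h v).trans_eq ?_
  simp

lemma norm_iteratedFDeriv_vector_le_of_mpd_le {n k : ℕ}
    {c : EuclideanSpace ℝ (Fin d) → EuclideanSpace ℝ (Fin d)}
    (hc : ContDiff ℝ n c) (hk : k ≤ n) {x : EuclideanSpace ℝ (Fin d)} {B : ℝ}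
    (hB : ∀ (ρ : Fin d) (ζ : Fin d → ℕ), ∑ i, ζ i = k → |mpd ζ (fun y => c y ρ) x| ≤ B) :
    ‖iteratedFDeriv ℝ k c x‖ ≤ d * (d ^ k * B) := by
  have hρ : ∀ ρ, ‖iteratedFDeriv ℝ k (fun y => c y ρ) x‖ ≤ d ^ k * B := fun ρ =>
    norm_iteratedFDeriv_le_of_mpd_le (contDiff_euclidean.1 hc ρ) hk (hB ρ)
  have hsum : ∑ ρ, ‖iteratedFDeriv ℝ k (fun y => c y ρ) x‖ ≤ d * (d ^ k * B) :=
    (Finset.sum_le_sum fun ρ _ => hρ ρ).trans_eq (by simp)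
  refine (ContinuousMultilinearMap.opNorm_le_bound
    (Finset.sum_nonneg fun _ _ => norm_nonneg _) fun m => ?_).trans hsum
  refine (norm_le_sum_abs _).trans ?_
  rw [Finset.sum_mul]
  refine Finset.sum_le_sum fun ρ _ => ?_
  have e : (iteratedFDeriv ℝ k c x m) ρ = iteratedFDeriv ℝ k (fun y => c y ρ) x m := by
    have := (EuclideanSpace.proj ρ : EuclideanSpace ℝ (Fin d) →L[ℝ] ℝ).iteratedFDeriv_comp_left
      (hc.contDiffAt (x := x)) (i := k) (by exact_mod_cast hk)
    exact (congrArg (fun g => g m) this).symm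
  rw [e]
  exact (iteratedFDeriv ℝ k (fun y => c y ρ) x).le_opNorm m

lemma mem_midx {n : ℕ} {ζ : Fin d → ℕ} : ζ ∈ midx d n ↔ ∑ i, ζ i ≤ n := by
  refine ⟨fun h => (Finset.mem_filter.1 h).2, fun h => Finset.mem_filter.2 ⟨?_, h⟩⟩
  refine Finset.mem_image.2 ⟨fun i => ⟨ζ i, Nat.lt_succ_of_le ?_⟩, Finset.mem_univ _, rfl⟩
  exact (Finset.single_le_sum (fun _ _ => Nat.zero_le _) (Finset.mem_univ i)).trans h

lemma abs_mpd_sub_le_norm {f g : EuclideanSpace ℝ (Fin d) → ℝ} (α : Fin d → ℕ)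
    (hf : ContDiff ℝ (∑ i, α i : ℕ) f) (hg : ContDiff ℝ (∑ i, α i : ℕ) g)
    (x y : EuclideanSpace ℝ (Fin d)) :
    |mpd α f x - mpd α g y| ≤
      ‖iteratedFDeriv ℝ (∑ i, α i) f x - iteratedFDeriv ℝ (∑ i, α i) g y‖ := by
  rw [← length_multiIndexList] at *
  rw [mpd_eq_listPd, mpd_eq_listPd, listPd_eq_iteratedFDeriv hf _ le_rfl,
    listPd_eq_iteratedFDeriv hg _ le_rfl, ← sub_apply]
  refine ((iteratedFDeriv ℝ (multiIndexList α).length f x -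
    iteratedFDeriv ℝ (multiIndexList α).length g y).le_opNorm _).trans_eq ?_
  simp

end MultiIndex

/-- First-order estimate for derivatives of a composition: there is `N = N(n,d,K)` such that
for every `Cⁿ` map `c` with derivatives up to order `n` bounded by `ε ≤ K`, every `Cⁿ`
function `u`, every multi-index `α` with `|α| = n` and every `x`,
`|∂^α(u ∘ T_c)(x) − (∂^α u)(x + c(x))| ≤ N ε Σ_{1 ≤ |ζ| ≤ n} |(∂^ζ u)(x + c(x))|`. -/
theorem degenerate_SIDE_stmt5 (d n : ℕ) (hd : 1 ≤ d) (hn : 1 ≤ n) (K : ℝ) (hK : 0 < K) :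
    ∃ N : ℝ, ∀ ε : ℝ, 0 < ε → ε ≤ K →
      ∀ c : EuclideanSpace ℝ (Fin d) → EuclideanSpace ℝ (Fin d),
        ContDiff ℝ (n : ℕ∞) c →
        (∀ β : Fin d → ℕ, (∑ i, β i) ≤ n →
          ∀ (ρ : Fin d) (x : EuclideanSpace ℝ (Fin d)), |mpd β (fun y => c y ρ) x| ≤ ε) →
        ∀ u : EuclideanSpace ℝ (Fin d) → ℝ, ContDiff ℝ (n : ℕ∞) u →
          ∀ α : Fin d → ℕ, (∑ i, α i) = n →
            ∀ x : EuclideanSpace ℝ (Fin d),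
              |mpd α (fun y => u (y + c y)) x - mpd α u (x + c x)| ≤
                N * ε * ∑ ζ ∈ (midx d n).filter (fun ζ => 1 ≤ ∑ i, ζ i),
                  |mpd ζ u (x + c x)| := by
  set C : ℝ := d * (d : ℝ) ^ n
  set D : ℝ := ∑ k ∈ Finset.Icc 1 n, (d : ℝ) ^ k
  have hd' : (1 : ℝ) ≤ d := by exact_mod_cast hd
  refine ⟨Fintype.card (OrderedFinpartition n) * (n * (1 + C * K) ^ n * C) * D, ?_⟩
  intro ε hε hεK c hc hcb u hu α hα x
  replace hc : ContDiff ℝ n c := hc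
  replace hu : ContDiff ℝ n u := hu
  set S := ∑ ζ ∈ (midx d n).filter (fun ζ => 1 ≤ ∑ i, ζ i), |mpd ζ u (x + c x)|
  have hck : ∀ k ∈ Finset.Icc 1 n, ‖iteratedFDeriv ℝ k c x‖ ≤ C * ε := by
    intro k hk
    have hkn := (Finset.mem_Icc.1 hk).2
    refine (norm_iteratedFDeriv_vector_le_of_mpd_le hc hkn
      fun ρ ζ hζ => hcb ζ (hζ.trans_le hkn) ρ x).trans ?_
    rw [← mul_assoc]
    gcongr
    exact mul_le_mul_of_nonneg_left (pow_le_pow_right₀ hd' hkn) (by positivity)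
  have huk : ∑ k ∈ Finset.Icc 1 n, ‖iteratedFDeriv ℝ k u (x + c x)‖ ≤ D * S := by
    rw [Finset.sum_mul]
    refine Finset.sum_le_sum fun k hk => ?_
    obtain ⟨h1, hkn⟩ := Finset.mem_Icc.1 hk
    refine norm_iteratedFDeriv_le_of_mpd_le hu hkn fun ζ hζ => ?_
    exact Finset.single_le_sum (f := fun ζ => |mpd ζ u (x + c x)|) (fun _ _ => abs_nonneg _)
      (Finset.mem_filter.2 ⟨mem_midx.2 (hζ.trans_le hkn), h1.trans_eq hζ.symm⟩)
  have hT : ContDiff ℝ n (fun y => u (y + c y)) := hu.comp (contDiff_id.add hc)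
  have hle := norm_iteratedFDeriv_comp_add_sub_le (by omega) hc hu x (by positivity) hck
  have hα' : |mpd α (fun y => u (y + c y)) x - mpd α u (x + c x)| ≤ _ :=
    abs_mpd_sub_le_norm α (hα.symm ▸ hT) (hα.symm ▸ hu) x (x + c x)
  rw [hα] at hα'
  refine hα'.trans (hle.trans ?_)
  calc _ ≤ Fintype.card (OrderedFinpartition n) * (n * (1 + C * K) ^ n * (C * ε)) * (D * S) := by
        gcongr
    _ = _ := by ring
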